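/- For n, m ∈ ℕ let P_{n,m} : ℂ → ℂ be the function P_{n,m} = (z̄ − ∂_z)^n (w ↦ w^m) (a polynomial in z and conj(z)). Then P_{n,m} is an eigenfunction of the angular momentum operator L̂ = z∂_z − z̄∂_{z̄} with eigenvalue m − n: for all z ∈ ℂ, z·(∂_z P_{n,m})(z) − conj(z)·(∂_{z̄} P_{n,m})(z) = (m − n)·P_{n,m}(z). -/

import Mathlib

noncomputable section

/-- Wirtinger derivative `∂_z F = ½(∂_x F − i ∂_y F)`. -/
def dz (F : ℂ → ℂ) (z : ℂ) : ℂ :=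
  (1 / 2 : ℂ) * (fderiv ℝ F z 1 - Complex.I * fderiv ℝ F z Complex.I)

/-- Wirtinger derivative `∂_{z̄} F = ½(∂_x F + i ∂_y F)`. -/
def dzbar (F : ℂ → ℂ) (z : ℂ) : ℂ :=
  (1 / 2 : ℂ) * (fderiv ℝ F z 1 + Complex.I * fderiv ℝ F z Complex.I)

/-- The operator `z̄ − ∂_z`. -/
def Tbar (F : ℂ → ℂ) : ℂ → ℂ := fun z => (starRingEnd ℂ) z * F z - dz F z

open ComplexConjugate

lemma hasFDerivAt_pow_mul_conj_pow (a b : ℕ) (z : ℂ) :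
    HasFDerivAt (𝕜 := ℝ) (fun w : ℂ => w ^ a * conj w ^ b)
      (z ^ a • ((b * conj z ^ (b - 1)) • (Complex.conjCLE : ℂ →L[ℝ] ℂ))
        + conj z ^ b • ((a * z ^ (a - 1)) • ContinuousLinearMap.id ℝ ℂ)) z := by
  have h := ((hasFDerivAt_id (𝕜 := ℝ) z).pow a).mul
    ((Complex.conjCLE : ℂ →L[ℝ] ℂ).hasFDerivAt (x := z).pow b)
  refine h.congr_fderiv ?_
  ext v
  simp

lemma dz_pow_mul_conj_pow (a b : ℕ) (z : ℂ) :
    dz (fun w => w ^ a * conj w ^ b) z = a * z ^ (a - 1) * conj z ^ b := by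
  rw [dz, (hasFDerivAt_pow_mul_conj_pow a b z).fderiv]
  simp
  linear_combination (z ^ a * (b * conj z ^ (b - 1)) / 2
    - conj z ^ b * (a * z ^ (a - 1)) / 2) * Complex.I_sq

lemma dzbar_pow_mul_conj_pow (a b : ℕ) (z : ℂ) :
    dzbar (fun w => w ^ a * conj w ^ b) z = b * z ^ a * conj z ^ (b - 1) := by
  rw [dzbar, (hasFDerivAt_pow_mul_conj_pow a b z).fderiv]
  simp
  linear_combination (- (z ^ a * (b * conj z ^ (b - 1)) / 2)
    + conj z ^ b * (a * z ^ (a - 1)) / 2) * Complex.I_sq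

lemma dz_add {F G : ℂ → ℂ} (hF : Differentiable ℝ F) (hG : Differentiable ℝ G) (z : ℂ) :
    dz (F + G) z = dz F z + dz G z := by
  simp only [dz, fderiv_add (hF z) (hG z), add_apply]
  ring

lemma dzbar_add {F G : ℂ → ℂ} (hF : Differentiable ℝ F) (hG : Differentiable ℝ G) (z : ℂ) :
    dzbar (F + G) z = dzbar F z + dzbar G z := by
  simp only [dzbar, fderiv_add (hF z) (hG z), add_apply]
  ring

lemma dz_smul {F : ℂ → ℂ} (hF : Differentiable ℝ F) (c z : ℂ) :
    dz (c • F) z = c * dz F z := by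
  simp only [dz, fderiv_const_smul (hF z) c, smul_apply, smul_eq_mul]
  ring

lemma dzbar_smul {F : ℂ → ℂ} (hF : Differentiable ℝ F) (c z : ℂ) :
    dzbar (c • F) z = c * dzbar F z := by
  simp only [dzbar, fderiv_const_smul (hF z) c, smul_apply, smul_eq_mul]
  ring

/-- The polynomials in `z` and `z̄` all of whose monomials `z ^ a * z̄ ^ b` have `a - b = k`. -/
def angularSpace (k : ℤ) : Submodule ℂ (ℂ → ℂ) :=
  Submodule.span ℂ {F | ∃ a b : ℕ, (a : ℤ) - b = k ∧ F = fun w => w ^ a * conj w ^ b}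

lemma pow_mul_conj_pow_mem_angularSpace {k : ℤ} {a b : ℕ} (h : (a : ℤ) - b = k) :
    (fun w : ℂ => w ^ a * conj w ^ b) ∈ angularSpace k :=
  Submodule.subset_span ⟨a, b, h, rfl⟩

lemma differentiable_of_mem_angularSpace {k : ℤ} {F : ℂ → ℂ} (hF : F ∈ angularSpace k) :
    Differentiable ℝ F := by
  induction hF using Submodule.span_induction with
  | mem F h =>
    obtain ⟨a, b, -, rfl⟩ := h
    exact fun z => (hasFDerivAt_pow_mul_conj_pow a b z).differentiableAt
  | zero => exact differentiable_const 0
  | add F G _ _ hF hG => exact hF.add hG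
  | smul c F _ hF => exact hF.const_smul c

/-- Elements of `angularSpace k` are eigenfunctions of `z∂_z − z̄∂_{z̄}` with eigenvalue `k`. -/
lemma angularMomentum_of_mem_angularSpace {k : ℤ} {F : ℂ → ℂ} (hF : F ∈ angularSpace k) (z : ℂ) :
    z * dz F z - conj z * dzbar F z = k * F z := by
  induction hF using Submodule.span_induction with
  | mem F h =>
    obtain ⟨a, b, rfl, rfl⟩ := h
    rw [dz_pow_mul_conj_pow, dzbar_pow_mul_conj_pow]
    cases a <;> cases b <;> simp <;> ring
  | zero => simp [dz, dzbar]
  | add F G hF hG ihF ihG =>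
    have dF := differentiable_of_mem_angularSpace hF
    have dG := differentiable_of_mem_angularSpace hG
    rw [dz_add dF dG, dzbar_add dF dG, Pi.add_apply]
    linear_combination ihF + ihG
  | smul c F hF ih =>
    have dF := differentiable_of_mem_angularSpace hF
    rw [dz_smul dF, dzbar_smul dF, Pi.smul_apply, smul_eq_mul]
    linear_combination c * ih

lemma Tbar_mem_angularSpace {k : ℤ} {F : ℂ → ℂ} (hF : F ∈ angularSpace k) :
    Tbar F ∈ angularSpace (k - 1) := by
  induction hF using Submodule.span_induction with
  | mem F h =>
    obtain ⟨a, b, rfl, rfl⟩ := h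
    have h₁ : (fun w : ℂ => w ^ a * conj w ^ (b + 1)) ∈ angularSpace ((a : ℤ) - b - 1) :=
      pow_mul_conj_pow_mem_angularSpace (by push_cast; ring)
    cases a with
    | zero =>
      convert h₁ using 1
      ext z
      rw [Tbar, dz_pow_mul_conj_pow]
      simp
      ring
    | succ a =>
      have h₂ : (fun w : ℂ => w ^ a * conj w ^ b) ∈ angularSpace (((a + 1 : ℕ) : ℤ) - b - 1) :=
        pow_mul_conj_pow_mem_angularSpace (by push_cast; ring)
      convert sub_mem h₁ (Submodule.smul_mem _ ((a + 1 : ℕ) : ℂ) h₂) using 1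
      ext z
      rw [Tbar, dz_pow_mul_conj_pow]
      simp
      ring
  | zero =>
    convert zero_mem (angularSpace (k - 1)) using 1
    ext z
    simp [Tbar, dz]
  | add F G hF hG ihF ihG =>
    convert add_mem ihF ihG using 1
    ext z
    simp only [Tbar, Pi.add_apply, dz_add (differentiable_of_mem_angularSpace hF)
      (differentiable_of_mem_angularSpace hG)]
    ring
  | smul c F hF ih =>
    convert Submodule.smul_mem _ c ih using 1
    ext z
    simp only [Tbar, Pi.smul_apply, smul_eq_mul, dz_smul (differentiable_of_mem_angularSpace hF)]
    ring

lemma iterate_Tbar_pow_mem_angularSpace (n m : ℕ) :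
    Tbar^[n] (fun w => w ^ m) ∈ angularSpace ((m : ℤ) - n) := by
  induction n with
  | zero => simpa using pow_mul_conj_pow_mem_angularSpace (a := m) (b := 0) rfl
  | succ n ih =>
    rw [Function.iterate_succ_apply']
    convert Tbar_mem_angularSpace ih using 2
    push_cast
    ring

/-- `P_{n,m} = (z̄ − ∂_z)^n (w ↦ w^m)` is an eigenfunction of the angular
momentum operator `L̂ = z∂_z − z̄∂_{z̄}` with eigenvalue `m − n`. -/
theorem stmt7 (n m : ℕ) :
    ∀ z : ℂ, z * dz (Tbar^[n] (fun w => w ^ m)) z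
        - (starRingEnd ℂ) z * dzbar (Tbar^[n] (fun w => w ^ m)) z
      = ((m : ℂ) - (n : ℂ)) * (Tbar^[n] (fun w => w ^ m)) z := by
  intro z
  simpa using angularMomentum_of_mem_angularSpace (iterate_Tbar_pow_mem_angularSpace n m) z
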